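/- Let K be a set of 14 points in PG(2,7) all of whose line multiplicities lie in {0,2,3,4,5}, and let (a_0,a_2,a_3,a_4,a_5) be its line spectrum. Then the spectrum is one of (10,37,2,8,0), (11,31,10,5,0), (12,25,18,2,0), (11,30,13,2,1), (10,36,5,5,1). -/

import Mathlib

open Module
open scoped Classical

instance : Fact (Nat.Prime 7) := ⟨by norm_num⟩

section Plane

variable (F : Type*) [Field F]

/-- The points of the projective plane over `F`. -/
def PlanePoint := {H : Submodule F (Fin 3 → F) // finrank F H = 1}

/-- The lines of the projective plane over `F`. -/
def PlaneLine := {H : Submodule F (Fin 3 → F) // finrank F H = 2}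

instance [Finite F] : Finite (PlanePoint F) := Subtype.finite

instance [Finite F] : Finite (PlaneLine F) := Subtype.finite

instance : Membership (PlanePoint F) (PlaneLine F) := ⟨fun l p => p.1 ≤ l.1⟩

variable {F}

theorem PlanePoint.mem_iff {p : PlanePoint F} {l : PlaneLine F} : p ∈ l ↔ p.1 ≤ l.1 := Iff.rfl

/-- The point spanned by a nonzero vector. -/
def PlanePoint.ofVec (v : Fin 3 → F) (hv : v ≠ 0) : PlanePoint F :=
  ⟨Submodule.span F {v}, finrank_span_singleton hv⟩

/-- The line with the given nonzero coordinate vector. -/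
noncomputable def PlaneLine.ofVec (w : Fin 3 → F) (hw : w ≠ 0) : PlaneLine F :=
  ⟨LinearMap.ker (dotProductBilin F F w), by
    have h : dotProductBilin F F w ≠ 0 := fun h =>
      hw (dotProduct_eq_zero w fun x => LinearMap.congr_fun h x)
    have := Module.Dual.finrank_ker_add_one_of_ne_zero h
    rw [finrank_fin_fun] at this
    lia⟩

theorem PlaneLine.ofVec_mem_ofVec {v w : Fin 3 → F} {hv : v ≠ 0} {hw : w ≠ 0} :
    PlanePoint.ofVec v hv ∈ PlaneLine.ofVec w hw ↔ w ⬝ᵥ v = 0 := by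
  rw [PlanePoint.mem_iff]
  simp [PlanePoint.ofVec, PlaneLine.ofVec]

theorem PlanePoint.finrank_sup_of_ne {p q : PlanePoint F} (h : p ≠ q) :
    finrank F ↥(p.1 ⊔ q.1) = 2 := by
  have hinf : finrank F ↥(p.1 ⊓ q.1) < 1 := by
    by_contra! hle
    have hp := Submodule.eq_of_le_of_finrank_le (inf_le_left : p.1 ⊓ q.1 ≤ p.1)
      (by rw [p.2]; exact hle)
    have hq := Submodule.eq_of_le_of_finrank_le (inf_le_right : p.1 ⊓ q.1 ≤ q.1)
      (by rw [q.2]; exact hle)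
    exact h (Subtype.ext (hp.symm.trans hq))
  have := Submodule.finrank_sup_add_finrank_inf_eq p.1 q.1
  rw [p.2, q.2] at this
  lia

theorem PlaneLine.finrank_inf_of_ne {l m : PlaneLine F} (h : l ≠ m) :
    finrank F ↥(l.1 ⊓ m.1) = 1 := by
  have hinf : finrank F ↥(l.1 ⊓ m.1) < 2 := by
    by_contra! hle
    have hl := Submodule.eq_of_le_of_finrank_le (inf_le_left : l.1 ⊓ m.1 ≤ l.1)
      (by rw [l.2]; exact hle)
    have hm := Submodule.eq_of_le_of_finrank_le (inf_le_right : l.1 ⊓ m.1 ≤ m.1)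
      (by rw [m.2]; exact hle)
    exact h (Subtype.ext (hl.symm.trans hm))
  have := Submodule.finrank_sup_add_finrank_inf_eq l.1 m.1
  have hsup := Submodule.finrank_le (l.1 ⊔ m.1)
  rw [finrank_fin_fun] at hsup
  rw [l.2, m.2] at this
  lia

noncomputable instance : Configuration.ProjectivePlane (PlanePoint F) (PlaneLine F) where
  exists_point l := by
    have hl : l.1 ≠ ⊤ := fun h => by
      have := l.2
      rw [h, finrank_top, finrank_fin_fun] at this
      lia
    obtain ⟨v, -, hv⟩ := SetLike.exists_of_lt hl.lt_top
    refine ⟨.ofVec v fun h => hv (h ▸ l.1.zero_mem), fun h => hv ?_⟩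
    exact h (Submodule.mem_span_singleton_self v)
  exists_line p := by
    obtain ⟨q, hq⟩ := p.1.exists_isCompl
    have hfin := Submodule.finrank_add_eq_of_isCompl hq
    rw [p.2, finrank_fin_fun] at hfin
    refine ⟨⟨q, by lia⟩, fun h => ?_⟩
    have hp := p.2
    rw [hq.disjoint.eq_bot_of_le h, finrank_bot] at hp
    lia
  eq_or_eq {p q l m} hpl hql hpm hqm := by
    by_contra! h
    have := Submodule.finrank_mono (le_inf (sup_le hpl hql) (sup_le hpm hqm))
    rw [PlanePoint.finrank_sup_of_ne h.1, PlaneLine.finrank_inf_of_ne h.2] at this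
    lia
  mkPoint h := ⟨_, PlaneLine.finrank_inf_of_ne h⟩
  mkPoint_ax _ := ⟨inf_le_left, inf_le_right⟩
  mkLine h := ⟨_, PlanePoint.finrank_sup_of_ne h⟩
  mkLine_ax _ := ⟨le_sup_left, le_sup_right⟩
  exists_config := by
    refine ⟨.ofVec ![1, 0, 0] ?_, .ofVec ![0, 1, 0] ?_, .ofVec ![0, 0, 1] ?_,
      .ofVec ![0, 1, -1] ?_, .ofVec ![1, 0, 0] ?_, .ofVec ![1, 0, -1] ?_, ?_⟩ <;>
      simp [PlaneLine.ofVec_mem_ofVec]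

theorem PlanePoint.order_eq [Finite F] :
    Configuration.ProjectivePlane.order (PlanePoint F) (PlaneLine F) = Nat.card F := by
  have := Fintype.ofFinite (PlanePoint F)
  have h := Configuration.ProjectivePlane.card_points (PlanePoint F) (PlaneLine F)
  have hcard : Nat.card (PlanePoint F) = ∑ i ∈ Finset.range 3, Nat.card F ^ i :=
    (Nat.card_congr (Projectivization.equivSubmodule F (Fin 3 → F))).symm.trans
      (Projectivization.card_of_finrank F _ (finrank_fin_fun F))
  rw [← Nat.card_eq_fintype_card, hcard] at h
  simp only [Finset.sum_range_succ, Finset.sum_range_zero] at h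
  nlinarith

end Plane

section Counting

open Configuration Configuration.ProjectivePlane Finset

variable {P L : Type*} [Membership P L] [ProjectivePlane P L] [Fintype L]

theorem card_lines_through_pair {p q : P} (h : p ≠ q) : #{l : L | p ∈ l ∧ q ∈ l} = 1 := by
  obtain ⟨l, hl, huniq⟩ := HasLines.existsUnique_line P L p q h
  rw [card_eq_one]
  exact ⟨l, by ext m; simpa using ⟨huniq m, fun h => h ▸ hl⟩⟩

variable [Fintype P]

theorem card_lines_through (p : P) : #{l : L | p ∈ l} = order P L + 1 := by
  rw [← lineCount_eq L p, lineCount, Nat.card_eq_fintype_card, Fintype.card_subtype]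

theorem sum_card_inter_pencil (A : Finset P) (p : P) :
    ∑ l : L with p ∈ l, #{x ∈ A | x ∈ l} = #A + if p ∈ A then order P L else 0 := by
  have h := sum_card_bipartiteAbove_eq_sum_card_bipartiteBelow (s := A)
    (t := ({l | p ∈ l} : Finset L)) (fun x l => x ∈ l)
  simp only [bipartiteAbove, bipartiteBelow, filter_filter] at h
  have hx : ∀ x ∈ A, #{l : L | p ∈ l ∧ x ∈ l} = 1 + if p = x then order P L else 0 := by
    intro x _
    split_ifs with hpx
    · subst hpx
      simp [card_lines_through, add_comm]
    · exact card_lines_through_pair hpx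
  rw [← h, sum_congr rfl hx, sum_add_distrib, sum_ite_eq]
  simp

theorem sum_card_inter_line (A : Finset P) :
    ∑ l : L, #{x ∈ A | x ∈ l} = #A * (order P L + 1) := by
  have h := sum_card_bipartiteAbove_eq_sum_card_bipartiteBelow (s := A)
    (t := (univ : Finset L)) (fun x l => x ∈ l)
  simp only [bipartiteAbove, bipartiteBelow, card_lines_through, sum_const, smul_eq_mul] at h
  exact h.symm

theorem sum_card_inter_line_sq (A : Finset P) :
    ∑ l : L, #{x ∈ A | x ∈ l} ^ 2 = #A * (#A + order P L) := by
  have h : ∀ p ∈ A, ∑ l : L, (if p ∈ l then #{x ∈ A | x ∈ l} else 0) = #A + order P L := by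
    intro p hp
    rw [← sum_filter, sum_card_inter_pencil, if_pos hp]
  rw [← smul_eq_mul, ← sum_const, ← sum_congr rfl h, sum_comm]
  refine sum_congr rfl fun l _ => ?_
  rw [← sum_filter, sum_const, smul_eq_mul, sq]

/-- In a plane of order 7, a point of a 14-set with no tangent lines is on at most one 5-secant. -/
theorem eq_of_five_secants_through (hq : order P L = 7) {K : Finset P} (hK : #K = 14)
    (hm : ∀ l : L, #{x ∈ K | x ∈ l} ≠ 1) {p : P} (hp : p ∈ K) {l₁ l₂ : L}
    (h₁ : #{x ∈ K | x ∈ l₁} = 5) (h₂ : #{x ∈ K | x ∈ l₂} = 5) (hp₁ : p ∈ l₁) (hp₂ : p ∈ l₂) :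
    l₁ = l₂ := by
  by_contra hne
  have hsum := sum_card_inter_pencil (L := L) K p
  have hcard := card_lines_through (L := L) p
  have hmem₁ : l₁ ∈ ({l | p ∈ l} : Finset L) := by simpa
  have hmem₂ : l₂ ∈ ({l | p ∈ l} : Finset L).erase l₁ := by simp [hp₂, Ne.symm hne]
  rw [if_pos hp, ← add_sum_erase _ _ hmem₁, ← add_sum_erase _ _ hmem₂] at hsum
  rw [← card_erase_add_one hmem₁, ← card_erase_add_one hmem₂] at hcard
  have hle : ∀ l ∈ (({l | p ∈ l} : Finset L).erase l₁).erase l₂, 2 ≤ #{x ∈ K | x ∈ l} := by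
    intro l hl
    have hpl : p ∈ l := by simpa using (mem_of_mem_erase (mem_of_mem_erase hl))
    have : 0 < #{x ∈ K | x ∈ l} := card_pos.2 ⟨p, by simp [hp, hpl]⟩
    have := hm l
    lia
  have := card_nsmul_le_sum _ _ _ hle
  rw [smul_eq_mul] at this
  lia

/-- In a plane of order 7, a 14-set with no tangent lines has at most one 5-secant. -/
theorem five_secant_unique (hq : order P L = 7) {K : Finset P} (hK : #K = 14)
    (hm : ∀ l : L, #{x ∈ K | x ∈ l} ≠ 1) {l₁ l₂ : L}
    (h₁ : #{x ∈ K | x ∈ l₁} = 5) (h₂ : #{x ∈ K | x ∈ l₂} = 5) : l₁ = l₂ := by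
  by_contra hne
  have hdisj : ∀ x ∈ K, x ∈ l₁ → x ∉ l₂ := fun x hx hx₁ hx₂ =>
    hne (eq_of_five_secants_through hq hK hm hx h₁ h₂ hx₁ hx₂)
  set T := {x ∈ K | x ∈ l₁ ∨ x ∈ l₂} with hT
  set S := {x ∈ K | ¬(x ∈ l₁ ∨ x ∈ l₂)} with hS
  set N := ({l | #{x ∈ T | x ∈ l} = 1} : Finset L) with hN
  have hsplit (A : Finset P) (hA : A ⊆ T) :
      #A = #{x ∈ A | x ∈ l₁} + #{x ∈ A | x ∈ l₂} := by
    rw [← card_union_of_disjoint]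
    · congr 1
      ext x
      have := @hA x
      grind
    · rw [disjoint_filter]
      exact fun x hx => hdisj x (by grind)
  have hT₁ : #{x ∈ T | x ∈ l₁} = 5 := by
    rw [← h₁]; congr 1; ext; grind
  have hT₂ : #{x ∈ T | x ∈ l₂} = 5 := by
    rw [← h₂]; congr 1; ext; grind
  have hTcard : #T = 10 := by rw [hsplit T subset_rfl, hT₁, hT₂]
  have hScard : #S = 4 := by
    have := card_filter_add_card_filter_not (s := K) (fun x => x ∈ l₁ ∨ x ∈ l₂)
    lia
  have hle_one (l m : L) (h : l ≠ m) : #{x ∈ {x ∈ T | x ∈ l} | x ∈ m} ≤ 1 := by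
    rw [card_le_one]
    intro a ha b hb
    simp only [mem_filter] at ha hb
    exact (Nondegenerate.eq_or_eq ha.1.2 hb.1.2 ha.2 hb.2).resolve_right h
  have hle_two (l : L) (hl₁ : l ≠ l₁) (hl₂ : l ≠ l₂) : #{x ∈ T | x ∈ l} ≤ 2 := by
    have := hsplit {x ∈ T | x ∈ l} (filter_subset _ _)
    have := hle_one l l₁ hl₁
    have := hle_one l l₂ hl₂
    lia
  -- every point of `T` lies on at least two lines meeting `T` only there
  have hTN : ∀ p ∈ T, 2 ≤ #{l ∈ N | p ∈ l} := by
    intro p hp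
    obtain ⟨l₀, hl₀, h₀⟩ : ∃ l₀ : L, p ∈ l₀ ∧ #{x ∈ T | x ∈ l₀} = 5 :=
      (mem_filter.1 hp).2.elim (⟨l₁, ·, hT₁⟩) (⟨l₂, ·, hT₂⟩)
    have hsum := sum_card_inter_pencil (L := L) T p
    have hcard := card_lines_through (L := L) p
    have hmem : l₀ ∈ ({l | p ∈ l} : Finset L) := by simpa
    rw [if_pos hp, ← add_sum_erase _ _ hmem] at hsum
    rw [← card_erase_add_one hmem] at hcard
    have hge : ∀ l ∈ ({l | p ∈ l} : Finset L).erase l₀,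
        2 ≤ #{x ∈ T | x ∈ l} + if l ∈ N then 1 else 0 := by
      intro l hl
      have hpl : p ∈ l := by simpa using mem_of_mem_erase hl
      have : 0 < #{x ∈ T | x ∈ l} := card_pos.2 ⟨p, by simp [hp, hpl]⟩
      split_ifs with h
      · lia
      · have : #{x ∈ T | x ∈ l} ≠ 1 := by simpa [hN] using h
        lia
    have := card_nsmul_le_sum _ _ _ hge
    rw [smul_eq_mul, sum_add_distrib, ← card_filter] at this
    have hsub : #{l ∈ ({l | p ∈ l} : Finset L).erase l₀ | l ∈ N} ≤ #{l ∈ N | p ∈ l} :=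
      card_le_card fun l => by simp +contextual
    lia
  -- every point of `S` lies on at most four lines meeting `T` exactly once
  have hSN : ∀ p ∈ S, #{l ∈ N | p ∈ l} ≤ 4 := by
    intro p hp
    obtain ⟨hpK, hp₁, hp₂⟩ : p ∈ K ∧ p ∉ l₁ ∧ p ∉ l₂ := by grind
    have hmk := HasPoints.mkPoint_ax (P := P) hne
    set z : P := HasPoints.mkPoint hne
    obtain ⟨l₀, hl₀, -⟩ := HasLines.existsUnique_line P L p z (by grind)
    have h₀ : #{x ∈ T | x ∈ l₀} = 0 := by
      rw [card_eq_zero, filter_eq_empty_iff]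
      intro x hx hxl
      have hxK : x ∈ K := by grind
      have hxz : x ≠ z := fun h => hdisj x hxK (h ▸ hmk.1) (h ▸ hmk.2)
      rcases (mem_filter.1 hx).2 with h | h
      · exact hp₁ ((Nondegenerate.eq_or_eq hxl hl₀.2 h hmk.1).resolve_left hxz ▸ hl₀.1)
      · exact hp₂ ((Nondegenerate.eq_or_eq hxl hl₀.2 h hmk.2).resolve_left hxz ▸ hl₀.1)
    have hsum := sum_card_inter_pencil (L := L) T p
    have hcard := card_lines_through (L := L) p
    have hmem : l₀ ∈ ({l | p ∈ l} : Finset L) := by simpa using hl₀.1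
    have hpT : p ∉ T := by grind
    rw [if_neg hpT, ← add_sum_erase _ _ hmem] at hsum
    rw [← card_erase_add_one hmem] at hcard
    have hle : ∀ l ∈ ({l | p ∈ l} : Finset L).erase l₀,
        #{x ∈ T | x ∈ l} + (if l ∈ N then 1 else 0) ≤ 2 := by
      intro l hl
      have hpl : p ∈ l := by simpa using mem_of_mem_erase hl
      have := hle_two l (fun h => hp₁ (h ▸ hpl)) (fun h => hp₂ (h ▸ hpl))
      split_ifs with h
      · have : #{x ∈ T | x ∈ l} = 1 := by simpa [hN] using h
        lia
      · lia
    have := sum_le_card_nsmul _ _ _ hle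
    rw [smul_eq_mul, sum_add_distrib, ← card_filter] at this
    have hsub : #{l ∈ N | p ∈ l} ≤ #{l ∈ ({l | p ∈ l} : Finset L).erase l₀ | l ∈ N} :=
      card_le_card fun l hl => by
        simp only [mem_filter] at hl
        have : l ≠ l₀ := by
          rintro rfl
          have := (mem_filter.1 hl.1).2
          lia
        simp [this, hl]
    lia
  have hTsum := sum_card_bipartiteAbove_eq_sum_card_bipartiteBelow (s := T) (t := N)
    (fun x l => x ∈ l)
  have hSsum := sum_card_bipartiteAbove_eq_sum_card_bipartiteBelow (s := S) (t := N)
    (fun x l => x ∈ l)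
  simp only [bipartiteAbove, bipartiteBelow] at hTsum hSsum
  have hmeet : ∀ l ∈ N, #{x ∈ T | x ∈ l} ≤ #{x ∈ S | x ∈ l} := by
    intro l hl
    have h1 : #{x ∈ T | x ∈ l} = 1 := (mem_filter.1 hl).2
    have hKl := card_filter_add_card_filter_not (s := {x ∈ K | x ∈ l})
      (fun x => x ∈ l₁ ∨ x ∈ l₂)
    rw [filter_comm, ← hT, filter_comm (fun x => x ∈ l) _ K, ← hS] at hKl
    have := hm l
    lia
  have := card_nsmul_le_sum _ _ _ hTN
  have := sum_le_card_nsmul _ _ _ hSN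
  have := sum_le_sum hmeet
  simp only [smul_eq_mul] at *
  lia

/-- The possible line spectra of a 14-set in a plane of order 7 whose line multiplicities
lie in `{0, 2, 3, 4, 5}`. -/
theorem spectrum_of_card_eq_fourteen (hq : order P L = 7) {K : Finset P} (hK : #K = 14)
    (hm : ∀ l : L, #{x ∈ K | x ∈ l} ∈ ({0, 2, 3, 4, 5} : Set ℕ)) (a : ℕ → ℕ)
    (ha : ∀ i, a i = #{l : L | #{x ∈ K | x ∈ l} = i}) :
    (a 0, a 2, a 3, a 4, a 5) = (10, 37, 2, 8, 0) ∨
    (a 0, a 2, a 3, a 4, a 5) = (11, 31, 10, 5, 0) ∨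
    (a 0, a 2, a 3, a 4, a 5) = (12, 25, 18, 2, 0) ∨
    (a 0, a 2, a 3, a 4, a 5) = (11, 30, 13, 2, 1) ∨
    (a 0, a 2, a 3, a 4, a 5) = (10, 36, 5, 5, 1) := by
  have hsum (f : ℕ → ℕ) : ∑ l : L, f #{x ∈ K | x ∈ l} =
      a 0 * f 0 + a 2 * f 2 + a 3 * f 3 + a 4 * f 4 + a 5 * f 5 := by
    rw [← sum_fiberwise_of_maps_to' (t := {0, 2, 3, 4, 5}) (fun l _ => by simpa using hm l)]
    simp [← ha, add_assoc]
  have hcard := hsum fun _ => 1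
  have hlin := hsum id
  have hsq := hsum (· ^ 2)
  simp only [id, sum_card_inter_line, sum_card_inter_line_sq, ← card_eq_sum_ones, card_univ,
    card_lines P L, hq, hK] at hcard hlin hsq
  have h5 : a 5 ≤ 1 := by
    rw [ha, card_le_one]
    intro l₁ h₁ l₂ h₂
    refine five_secant_unique hq hK (fun l => ?_) (mem_filter.1 h₁).2 (mem_filter.1 h₂).2
    have := hm l
    grind
  have h4 : a 4 = 2 ∨ a 4 = 5 ∨ a 4 = 8 := by lia
  simp only [Prod.mk.injEq]
  obtain h5 | h5 : a 5 = 0 ∨ a 5 = 1 := by lia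
  all_goals rcases h4 with h4 | h4 | h4 <;> lia

end Counting

/-- a set `K` of `14` points in `PG(2,7)` all of whose line
multiplicities lie in `{0,2,3,4,5}` has line spectrum `(a 0, a 2, a 3, a 4, a 5)`
equal to one of `(10,37,2,8,0)`, `(11,31,10,5,0)`, `(12,25,18,2,0)`,
`(11,30,13,2,1)`, `(10,36,5,5,1)`. -/
theorem stmt16 (K : Finset (Submodule (ZMod 7) (Fin 3 → ZMod 7)))
    (hpts : ∀ P ∈ K, finrank (ZMod 7) P = 1)
    (hcard : K.card = 14)
    (hlines : ∀ L : Submodule (ZMod 7) (Fin 3 → ZMod 7), finrank (ZMod 7) L = 2 →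
      (K.filter fun P => P ≤ L).card ∈ ({0, 2, 3, 4, 5} : Set ℕ))
    (a : ℕ → ℕ)
    (ha : ∀ i, a i = Nat.card {L : Submodule (ZMod 7) (Fin 3 → ZMod 7) //
        finrank (ZMod 7) L = 2 ∧ (K.filter fun P => P ≤ L).card = i}) :
    (a 0, a 2, a 3, a 4, a 5) = (10, 37, 2, 8, 0) ∨
    (a 0, a 2, a 3, a 4, a 5) = (11, 31, 10, 5, 0) ∨
    (a 0, a 2, a 3, a 4, a 5) = (12, 25, 18, 2, 0) ∨
    (a 0, a 2, a 3, a 4, a 5) = (11, 30, 13, 2, 1) ∨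
    (a 0, a 2, a 3, a 4, a 5) = (10, 36, 5, 5, 1) := by
  have := Fintype.ofFinite (PlanePoint (ZMod 7))
  have := Fintype.ofFinite (PlaneLine (ZMod 7))
  have hq : Configuration.ProjectivePlane.order (PlanePoint (ZMod 7)) (PlaneLine (ZMod 7)) = 7 := by
    rw [PlanePoint.order_eq, Nat.card_zmod]
  let K' : Finset (PlanePoint (ZMod 7)) := Finset.univ.filter fun p => p.1 ∈ K
  have hK' (q : Submodule (ZMod 7) (Fin 3 → ZMod 7) → Prop) :
      (K'.filter fun p => q p.1).card = (K.filter q).card := by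
    refine Finset.card_bij (fun p _ => p.1) (fun p hp => ?_)
      (fun p _ p' _ h => Subtype.ext h) (fun H hH => ?_)
    · simpa [K'] using hp
    · rw [Finset.mem_filter] at hH
      exact ⟨⟨H, hpts H hH.1⟩, Finset.mem_filter.2
        ⟨Finset.mem_filter.2 ⟨Finset.mem_univ _, hH.1⟩, hH.2⟩, rfl⟩
  have hKl (l : PlaneLine (ZMod 7)) :
      (K'.filter fun p => p ∈ l).card = (K.filter fun P => P ≤ l.1).card :=
    hK' (· ≤ l.1)
  refine spectrum_of_card_eq_fourteen (K := K') hq ?_ (fun l => hKl l ▸ hlines l.1 l.2) a ?_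
  · simpa [hcard] using hK' fun _ => True
  · intro i
    rw [ha, ← Fintype.card_subtype, ← Nat.card_eq_fintype_card]
    simp only [hKl]
    exact Nat.card_congr (Equiv.subtypeSubtypeEquivSubtypeInter _ _).symm
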